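/- For every real κ > 1, (23κ⁴ − 25κ² + 2)/(3κ²·√(κ² − 1)·(3κ² + 4)) < arccos(1/κ). -/

import Mathlib

/-- A rational lower bound for the arctangent on the positive half-line. -/
theorem rational_lt_arctan {t : ℝ} (ht : 0 < t) :
    t * (23 * t ^ 2 + 21) / (3 * (1 + t ^ 2) * (3 * t ^ 2 + 7)) < Real.arctan t := by
  let G : ℝ → ℝ := fun x =>
    Real.arctan x - x * (23 * x ^ 2 + 21) / (3 * (1 + x ^ 2) * (3 * x ^ 2 + 7))
  have hG (x : ℝ) : HasDerivAt G
      ((96 * x ^ 6 + 112 * x ^ 4) / (3 * ((1 + x ^ 2) * (3 * x ^ 2 + 7)) ^ 2)) x := by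
    have hsq : HasDerivAt (fun y : ℝ => y ^ 2) (2 * x) x := by
      simpa using hasDerivAt_pow 2 x
    have hnum := (hasDerivAt_id x).mul ((hsq.const_mul 23).add_const 21)
    have hden := ((hsq.const_add 1).const_mul 3).mul ((hsq.const_mul 3).add_const 7)
    have hne : 3 * (1 + x ^ 2) * (3 * x ^ 2 + 7) ≠ 0 := by positivity
    refine ((Real.hasDerivAt_arctan x).sub (hnum.div hden hne)).congr_deriv ?_
    simp only [id, Pi.mul_apply]
    have h1 : 1 + x ^ 2 ≠ 0 := by positivity
    have h2 : 3 * x ^ 2 + 7 ≠ 0 := by positivity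
    field_simp
    ring
  have hmono : StrictMonoOn G (Set.Ici 0) := by
    refine strictMonoOn_of_deriv_pos (convex_Ici 0)
      (fun x _ => (hG x).continuousAt.continuousWithinAt) fun x hx => ?_
    rw [interior_Ici, Set.mem_Ioi] at hx
    rw [(hG x).deriv]
    positivity
  have h := hmono Set.self_mem_Ici ht.le ht
  simp only [G, Real.arctan_zero, zero_mul, zero_div, sub_zero] at h
  linarith

/-- For every `κ > 1`, `(23κ⁴ − 25κ² + 2)/(3κ²·√(κ² − 1)·(3κ² + 4)) < arccos(1/κ)`. -/
theorem rational_lt_arccos_inv (κ : ℝ) (hκ : 1 < κ) :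
    (23 * κ ^ 4 - 25 * κ ^ 2 + 2)
      / (3 * κ ^ 2 * Real.sqrt (κ ^ 2 - 1) * (3 * κ ^ 2 + 4))
      < Real.arccos (1 / κ) := by
  have hκ0 : 0 < κ := by linarith
  have hpos : 0 < κ ^ 2 - 1 := by nlinarith
  have hs : 0 < √(κ ^ 2 - 1) := Real.sqrt_pos.2 hpos
  have hsq : √(κ ^ 2 - 1) ^ 2 = κ ^ 2 - 1 := Real.sq_sqrt hpos.le
  have harccos : Real.arccos (1 / κ) = Real.arctan √(κ ^ 2 - 1) := by
    rw [Real.arccos_eq_arctan (by positivity)]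
    have h : 1 - (1 / κ) ^ 2 = (κ ^ 2 - 1) / κ ^ 2 := by field_simp
    rw [h, Real.sqrt_div hpos.le, Real.sqrt_sq hκ0.le]
    congr 1
    field_simp
  rw [harccos]
  convert rational_lt_arctan hs using 1
  have hden : 3 * (κ ^ 2 - 1) + 7 = 3 * κ ^ 2 + 4 := by ring
  rw [hsq, hden, add_sub_cancel, div_eq_div_iff (by positivity) (by positivity)]
  linear_combination -(3 * κ ^ 2 * (3 * κ ^ 2 + 4) * (23 * κ ^ 2 - 2)) * hsq
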